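/- arXiv:1902.05240 — 3 statements merged into one kernel-verified Lean document; each statement's English description precedes it below -/
import Mathlib

section
/- Each of the following ℤ-linear maps of H = ℤ^{4g+2} is an automorphism of H and preserves the bilinear form Q, i.e. Q(φσ, φτ) = Q(σ, τ) for all σ, τ ∈ H: the maps R_{z_i}, R_{x_i}, R_{z_i+z_j}, R_{z_i+x_j} (for all 1 ≤ i, j ≤ g with i ≠ j), D_{x_iy}, D_{z_it}, D_{x_it}, D_{z_iy} (for all 1 ≤ i ≤ g), f_y, and f_t. -/
/-!
Model for `H₂(Σ_g × T²) ≅ ℤ^(4g+2)`: index set `(Fin g × Fin 4) ⊕ Fin 2`,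
where for a block `i`, the four coordinates `(i,0), (i,1), (i,2), (i,3)` are
`a_i, b_i, c_i, d_i`, and `Sum.inr 0`, `Sum.inr 1` are `e`, `f`.
Blocks are indexed `0, …, g-1` (corresponding to `1, …, g` in the paper).
-/

namespace MinGenusT2

abbrev Idx (g : ℕ) := (Fin g × Fin 4) ⊕ Fin 2

/-- `H = ℤ^{4g+2}`. -/
abbrev Hmod (g : ℕ) := Idx g → ℤ

variable {g : ℕ}

def aIx (i : Fin g) : Idx g := Sum.inl (i, 0)
def bIx (i : Fin g) : Idx g := Sum.inl (i, 1)
def cIx (i : Fin g) : Idx g := Sum.inl (i, 2)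
def dIx (i : Fin g) : Idx g := Sum.inl (i, 3)
def eIx : Idx g := Sum.inr 0
def fIx : Idx g := Sum.inr 1

/-- The intersection form `Q`, an orthogonal sum of `2g+1` hyperbolic planes. -/
def Q (σ τ : Hmod g) : ℤ :=
  (∑ i : Fin g, (σ (aIx i) * τ (bIx i) + τ (aIx i) * σ (bIx i)
      + σ (cIx i) * τ (dIx i) + τ (cIx i) * σ (dIx i)))
    + σ eIx * τ fIx + τ eIx * σ fIx

/-- `R_{z_i}` : `b_i ↦ b_i − c_i`, `d_i ↦ d_i + a_i`. -/
def Rz (i : Fin g) : Hmod g → Hmod g := fun σ k =>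
  if k = bIx i then σ (bIx i) - σ (cIx i)
  else if k = dIx i then σ (dIx i) + σ (aIx i)
  else σ k

/-- `R_{x_i}` : `a_i ↦ a_i − d_i`, `c_i ↦ c_i + b_i`. -/
def Rx (i : Fin g) : Hmod g → Hmod g := fun σ k =>
  if k = aIx i then σ (aIx i) - σ (dIx i)
  else if k = cIx i then σ (cIx i) + σ (bIx i)
  else σ k

/-- `R_{z_i+z_j}` (`i ≠ j`). -/
def Rzz (i j : Fin g) : Hmod g → Hmod g := fun σ k =>
  if k = bIx i then σ (bIx i) - σ (cIx i) - σ (cIx j)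
  else if k = dIx i then σ (dIx i) + σ (aIx i) + σ (aIx j)
  else if k = bIx j then σ (bIx j) - σ (cIx i) - σ (cIx j)
  else if k = dIx j then σ (dIx j) + σ (aIx i) + σ (aIx j)
  else σ k

/-- `R_{z_i+x_j}` (`i ≠ j`). -/
def Rzx (i j : Fin g) : Hmod g → Hmod g := fun σ k =>
  if k = bIx i then σ (bIx i) - σ (cIx i) + σ (bIx j)
  else if k = dIx i then σ (dIx i) + σ (aIx i) + σ (dIx j)
  else if k = aIx j then σ (aIx j) - σ (aIx i) - σ (dIx j)
  else if k = cIx j then σ (cIx j) - σ (cIx i) + σ (bIx j)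
  else σ k

/-- `D_{x_iy}` : `d_i ↦ d_i + e`, `f ↦ f − c_i`. -/
def Dxy (i : Fin g) : Hmod g → Hmod g := fun σ k =>
  if k = dIx i then σ (dIx i) + σ eIx
  else if k = fIx then σ fIx - σ (cIx i)
  else σ k

/-- `D_{z_it}` : `c_i ↦ c_i + e`, `f ↦ f − d_i`. -/
def Dzt (i : Fin g) : Hmod g → Hmod g := fun σ k =>
  if k = cIx i then σ (cIx i) + σ eIx
  else if k = fIx then σ fIx - σ (dIx i)
  else σ k

/-- `D_{x_it}` : `b_i ↦ b_i + e`, `f ↦ f − a_i`. -/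
def Dxt (i : Fin g) : Hmod g → Hmod g := fun σ k =>
  if k = bIx i then σ (bIx i) + σ eIx
  else if k = fIx then σ fIx - σ (aIx i)
  else σ k

/-- `D_{z_iy}` : `a_i ↦ a_i + e`, `f ↦ f − b_i`. -/
def Dzy (i : Fin g) : Hmod g → Hmod g := fun σ k =>
  if k = aIx i then σ (aIx i) + σ eIx
  else if k = fIx then σ fIx - σ (bIx i)
  else σ k

/-- `f_y` : `b_i ↦ b_i − d_i`, `c_i ↦ c_i + a_i` for every `i`. -/
def fy : Hmod g → Hmod g := fun σ k =>
  match k with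
  | Sum.inl (i, q) =>
      if q = 1 then σ (bIx i) - σ (dIx i)
      else if q = 2 then σ (cIx i) + σ (aIx i)
      else σ (Sum.inl (i, q))
  | Sum.inr r => σ (Sum.inr r)

/-- `f_t` : `a_i ↦ a_i + c_i`, `d_i ↦ d_i − b_i` for every `i`. -/
def ft : Hmod g → Hmod g := fun σ k =>
  match k with
  | Sum.inl (i, q) =>
      if q = 0 then σ (aIx i) + σ (cIx i)
      else if q = 3 then σ (dIx i) - σ (bIx i)
      else σ (Sum.inl (i, q))
  | Sum.inr r => σ (Sum.inr r)

/-- A linear endomorphism `φ` with `(φ - 1)² = 0` is bijective, with inverse `2 - φ`. -/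
theorem bijective_of_sub_one_sq_eq_zero {M : Type*} [AddCommGroup M] {φ : M → M}
    (hφ : IsLinearMap ℤ φ) (h : ∀ σ, φ (φ σ) = φ σ + φ σ - σ) : Function.Bijective φ := by
  refine Function.bijective_iff_has_inverse.2 ⟨fun σ => σ + σ - φ σ, fun σ => ?_, fun σ => ?_⟩
  · simp only [h]; abel
  · simp only [hφ.map_sub, hφ.map_add, h]; abel

theorem sum_sub_sum_eq_of_eq_off_single {ι : Type*} [Fintype ι] {F G : ι → ℤ}
    (i : ι) (h : ∀ k, k ≠ i → F k = G k) : ∑ k, F k - ∑ k, G k = F i - G i := by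
  rw [← Finset.sum_sub_distrib]
  exact Fintype.sum_eq_single i fun k hk => sub_eq_zero.2 (h k hk)

theorem sum_sub_sum_eq_of_eq_off_pair {ι : Type*} [Fintype ι] {F G : ι → ℤ} {i j : ι}
    (hij : i ≠ j) (h : ∀ k, k ≠ i → k ≠ j → F k = G k) :
    ∑ k, F k - ∑ k, G k = (F i - G i) + (F j - G j) := by
  rw [← Finset.sum_sub_distrib]
  exact Fintype.sum_eq_add i j hij fun k hk => sub_eq_zero.2 (h k hk.1 hk.2)

/-- The contribution of the `k`-th block to `Q`. -/
def blockForm (σ τ : Hmod g) (k : Fin g) : ℤ :=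
  σ (aIx k) * τ (bIx k) + τ (aIx k) * σ (bIx k) + σ (cIx k) * τ (dIx k) + τ (cIx k) * σ (dIx k)

theorem Q_eq_of_block_single {σ τ σ' τ' : Hmod g} (i : Fin g)
    (h : ∀ k, k ≠ i → blockForm σ' τ' k = blockForm σ τ k)
    (hi : blockForm σ' τ' i + σ' eIx * τ' fIx + τ' eIx * σ' fIx
      = blockForm σ τ i + σ eIx * τ fIx + τ eIx * σ fIx) : Q σ' τ' = Q σ τ := by
  have := sum_sub_sum_eq_of_eq_off_single i h
  change ∑ k, blockForm σ' τ' k + _ + _ = ∑ k, blockForm σ τ k + _ + _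
  linarith

theorem Q_eq_of_block_pair {σ τ σ' τ' : Hmod g} {i j : Fin g} (hij : i ≠ j)
    (h : ∀ k, k ≠ i → k ≠ j → blockForm σ' τ' k = blockForm σ τ k)
    (h' : blockForm σ' τ' i + blockForm σ' τ' j + σ' eIx * τ' fIx + τ' eIx * σ' fIx
      = blockForm σ τ i + blockForm σ τ j + σ eIx * τ fIx + τ eIx * σ fIx) :
    Q σ' τ' = Q σ τ := by
  have := sum_sub_sum_eq_of_eq_off_pair hij h
  change ∑ k, blockForm σ' τ' k + _ + _ = ∑ k, blockForm σ τ k + _ + _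
  linarith

/-- `φ` is a `ℤ`-linear automorphism preserving `Q`. -/
def IsIsometry (φ : Hmod g → Hmod g) : Prop :=
  IsLinearMap ℤ φ ∧ Function.Bijective φ ∧ ∀ σ τ : Hmod g, Q (φ σ) (φ τ) = Q σ τ

theorem IsIsometry.of_sub_one_sq_eq_zero {φ : Hmod g → Hmod g}
    (hadd : ∀ σ τ, φ (σ + τ) = φ σ + φ τ) (hsq : ∀ σ, φ (φ σ) = φ σ + φ σ - σ)
    (hQ : ∀ σ τ, Q (φ σ) (φ τ) = Q σ τ) : IsIsometry φ :=
  have hlin : IsLinearMap ℤ φ := (AddMonoidHom.mk' φ hadd).toIntLinearMap.isLinear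
  ⟨hlin, bijective_of_sub_one_sq_eq_zero hlin hsq, hQ⟩

theorem isIsometry_Rz (i : Fin g) : IsIsometry (Rz i) := by
  refine .of_sub_one_sq_eq_zero (fun σ τ => ?_) (fun σ => ?_) fun σ τ =>
    Q_eq_of_block_single i (fun k hk => ?_) ?_
  · ext k; simp only [Rz, Pi.add_apply]; split_ifs <;> ring
  · ext k
    simp only [Rz, Pi.add_apply, Pi.sub_apply]
    split_ifs <;> simp_all [aIx, bIx, cIx, dIx] <;> ring
  · simp [blockForm, Rz, aIx, bIx, cIx, dIx, hk]
  · simp [blockForm, Rz, aIx, bIx, cIx, dIx, eIx, fIx]; ring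

theorem isIsometry_Rx (i : Fin g) : IsIsometry (Rx i) := by
  refine .of_sub_one_sq_eq_zero (fun σ τ => ?_) (fun σ => ?_) fun σ τ =>
    Q_eq_of_block_single i (fun k hk => ?_) ?_
  · ext k; simp only [Rx, Pi.add_apply]; split_ifs <;> ring
  · ext k
    simp only [Rx, Pi.add_apply, Pi.sub_apply]
    split_ifs <;> simp_all [aIx, bIx, cIx, dIx] <;> ring
  · simp [blockForm, Rx, aIx, bIx, cIx, dIx, hk]
  · simp [blockForm, Rx, aIx, bIx, cIx, dIx, eIx, fIx]; ring

theorem isIsometry_Rzz {i j : Fin g} (hij : i ≠ j) : IsIsometry (Rzz i j) := by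
  refine .of_sub_one_sq_eq_zero (fun σ τ => ?_) (fun σ => ?_) fun σ τ =>
    Q_eq_of_block_pair hij (fun k hi hj => ?_) ?_
  · ext k; simp only [Rzz, Pi.add_apply]; split_ifs <;> ring
  · ext (⟨k, q⟩ | r)
    · rcases eq_or_ne k i with rfl | hi
      · fin_cases q <;> simp [Rzz, aIx, bIx, cIx, dIx, hij, hij.symm] <;> ring
      · rcases eq_or_ne k j with rfl | hj
        · fin_cases q <;> simp [Rzz, aIx, bIx, cIx, dIx, hij, hij.symm] <;> ring
        · simp [Rzz, bIx, dIx, hi, hj]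
    · simp [Rzz, bIx, dIx]
  · simp [blockForm, Rzz, aIx, bIx, cIx, dIx, hi, hj]
  · simp [blockForm, Rzz, aIx, bIx, cIx, dIx, eIx, fIx, hij, hij.symm]; ring

theorem isIsometry_Rzx {i j : Fin g} (hij : i ≠ j) : IsIsometry (Rzx i j) := by
  refine .of_sub_one_sq_eq_zero (fun σ τ => ?_) (fun σ => ?_) fun σ τ =>
    Q_eq_of_block_pair hij (fun k hi hj => ?_) ?_
  · ext k; simp only [Rzx, Pi.add_apply]; split_ifs <;> ring
  · ext (⟨k, q⟩ | r)
    · rcases eq_or_ne k i with rfl | hi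
      · fin_cases q <;> simp [Rzx, aIx, bIx, cIx, dIx, hij, hij.symm] <;> ring
      · rcases eq_or_ne k j with rfl | hj
        · fin_cases q <;> simp [Rzx, aIx, bIx, cIx, dIx, hij, hij.symm] <;> ring
        · simp [Rzx, aIx, bIx, cIx, dIx, hi, hj]
    · simp [Rzx, aIx, bIx, cIx, dIx]
  · simp [blockForm, Rzx, aIx, bIx, cIx, dIx, hi, hj]
  · simp [blockForm, Rzx, aIx, bIx, cIx, dIx, eIx, fIx, hij, hij.symm]; ring

theorem isIsometry_Dxy (i : Fin g) : IsIsometry (Dxy i) := by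
  refine .of_sub_one_sq_eq_zero (fun σ τ => ?_) (fun σ => ?_) fun σ τ =>
    Q_eq_of_block_single i (fun k hk => ?_) ?_
  · ext k; simp only [Dxy, Pi.add_apply]; split_ifs <;> ring
  · ext k
    simp only [Dxy, Pi.add_apply, Pi.sub_apply]
    split_ifs <;> simp_all [cIx, dIx, eIx, fIx] <;> ring
  · simp [blockForm, Dxy, aIx, bIx, cIx, dIx, fIx, hk]
  · simp [blockForm, Dxy, aIx, bIx, cIx, dIx, eIx, fIx]; ring

theorem isIsometry_Dzt (i : Fin g) : IsIsometry (Dzt i) := by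
  refine .of_sub_one_sq_eq_zero (fun σ τ => ?_) (fun σ => ?_) fun σ τ =>
    Q_eq_of_block_single i (fun k hk => ?_) ?_
  · ext k; simp only [Dzt, Pi.add_apply]; split_ifs <;> ring
  · ext k
    simp only [Dzt, Pi.add_apply, Pi.sub_apply]
    split_ifs <;> simp_all [cIx, dIx, eIx, fIx] <;> ring
  · simp [blockForm, Dzt, aIx, bIx, cIx, dIx, fIx, hk]
  · simp [blockForm, Dzt, aIx, bIx, cIx, dIx, eIx, fIx]; ring

theorem isIsometry_Dxt (i : Fin g) : IsIsometry (Dxt i) := by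
  refine .of_sub_one_sq_eq_zero (fun σ τ => ?_) (fun σ => ?_) fun σ τ =>
    Q_eq_of_block_single i (fun k hk => ?_) ?_
  · ext k; simp only [Dxt, Pi.add_apply]; split_ifs <;> ring
  · ext k
    simp only [Dxt, Pi.add_apply, Pi.sub_apply]
    split_ifs <;> simp_all [aIx, bIx, eIx, fIx] <;> ring
  · simp [blockForm, Dxt, aIx, bIx, cIx, dIx, fIx, hk]
  · simp [blockForm, Dxt, aIx, bIx, cIx, dIx, eIx, fIx]; ring

theorem isIsometry_Dzy (i : Fin g) : IsIsometry (Dzy i) := by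
  refine .of_sub_one_sq_eq_zero (fun σ τ => ?_) (fun σ => ?_) fun σ τ =>
    Q_eq_of_block_single i (fun k hk => ?_) ?_
  · ext k; simp only [Dzy, Pi.add_apply]; split_ifs <;> ring
  · ext k
    simp only [Dzy, Pi.add_apply, Pi.sub_apply]
    split_ifs <;> simp_all [aIx, bIx, eIx, fIx] <;> ring
  · simp [blockForm, Dzy, aIx, bIx, cIx, dIx, fIx, hk]
  · simp [blockForm, Dzy, aIx, bIx, cIx, dIx, eIx, fIx]; ring

theorem isIsometry_fy : IsIsometry (fy : Hmod g → Hmod g) := by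
  refine .of_sub_one_sq_eq_zero (fun σ τ => ?_) (fun σ => ?_) fun σ τ => ?_
  · ext (⟨k, q⟩ | r)
    · simp only [fy, Pi.add_apply]; split_ifs <;> ring
    · rfl
  · ext (⟨k, q⟩ | r)
    · fin_cases q <;> simp [fy, aIx, bIx, cIx, dIx] <;> ring
    · simp [fy]
  · have h : ∀ k, blockForm (fy σ) (fy τ) k = blockForm σ τ k := fun k => by
      simp [blockForm, fy, aIx, bIx, cIx, dIx]; ring
    exact congrArg (fun s => s + σ eIx * τ fIx + τ eIx * σ fIx)
      (Finset.sum_congr rfl fun k _ => h k)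

theorem isIsometry_ft : IsIsometry (ft : Hmod g → Hmod g) := by
  refine .of_sub_one_sq_eq_zero (fun σ τ => ?_) (fun σ => ?_) fun σ τ => ?_
  · ext (⟨k, q⟩ | r)
    · simp only [ft, Pi.add_apply]; split_ifs <;> ring
    · rfl
  · ext (⟨k, q⟩ | r)
    · fin_cases q <;> simp [ft, aIx, bIx, cIx, dIx] <;> ring
    · simp [ft]
  · have h : ∀ k, blockForm (ft σ) (ft τ) k = blockForm σ τ k := fun k => by
      simp [blockForm, ft, aIx, bIx, cIx, dIx]; ring
    exact congrArg (fun s => s + σ eIx * τ fIx + τ eIx * σ fIx)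
      (Finset.sum_congr rfl fun k _ => h k)

/-- each of the maps `R_{z_i}`, `R_{x_i}`, `R_{z_i+z_j}`, `R_{z_i+x_j}`
(`i ≠ j`), `D_{x_iy}`, `D_{z_it}`, `D_{x_it}`, `D_{z_iy}`, `f_y`, `f_t` is a ℤ-linear
automorphism of `H = ℤ^{4g+2}` preserving the bilinear form `Q`. -/
theorem statement0 (g : ℕ) (hg : 1 ≤ g) (φ : Hmod g → Hmod g)
    (hφ : (∃ i, φ = Rz i) ∨ (∃ i, φ = Rx i) ∨
      (∃ i j, i ≠ j ∧ φ = Rzz i j) ∨ (∃ i j, i ≠ j ∧ φ = Rzx i j) ∨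
      (∃ i, φ = Dxy i) ∨ (∃ i, φ = Dzt i) ∨ (∃ i, φ = Dxt i) ∨ (∃ i, φ = Dzy i) ∨
      φ = fy ∨ φ = ft) :
    IsLinearMap ℤ φ ∧ Function.Bijective φ ∧ ∀ σ τ : Hmod g, Q (φ σ) (φ τ) = Q σ τ := by
  rcases hφ with ⟨i, rfl⟩ | ⟨i, rfl⟩ | ⟨i, j, hij, rfl⟩ | ⟨i, j, hij, rfl⟩ | ⟨i, rfl⟩ | ⟨i, rfl⟩ |
    ⟨i, rfl⟩ | ⟨i, rfl⟩ | rfl | rfl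
  · exact isIsometry_Rz i
  · exact isIsometry_Rx i
  · exact isIsometry_Rzz hij
  · exact isIsometry_Rzx hij
  · exact isIsometry_Dxy i
  · exact isIsometry_Dzt i
  · exact isIsometry_Dxt i
  · exact isIsometry_Dzy i
  · exact isIsometry_fy
  · exact isIsometry_ft

end MinGenusT2
end

section
/- (Lemma 1, algebraic form.) For every σ ∈ H = ℤ^{4g+2} there exists an element φ of the subgroup of GL(H) generated by the maps R_{z_i}, R_{x_i}, R_{z_i+z_j}, R_{z_i+x_j} (for all 1 ≤ i, j ≤ g with i ≠ j) such that b_i(φ(σ)) = 0 and d_i(φ(σ)) = 0 for every i with 2 ≤ i ≤ g. -/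
/-!
Model for `H₂(Σ_g × T²) ≅ ℤ^(4g+2)`: index set `(Fin g × Fin 4) ⊕ Fin 2`,
where for a block `i`, the four coordinates `(i,0), (i,1), (i,2), (i,3)` are
`a_i, b_i, c_i, d_i`, and `Sum.inr 0`, `Sum.inr 1` are `e`, `f`.
Blocks are indexed `0, …, g-1` (corresponding to `1, …, g` in the paper).
-/

namespace MinGenusT2

variable {g : ℕ}

/-- The set of Dehn-twist-induced automorphisms
`R_{z_i}, R_{x_i}, R_{z_i+z_j}, R_{z_i+x_j}` (`i ≠ j`), as elements of `GL(H)`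
(the group of ℤ-linear automorphisms of `H`). -/
def dehnGens (g : ℕ) : Set (Hmod g ≃ₗ[ℤ] Hmod g) :=
  {φ | (∃ i, ⇑φ = Rz i) ∨ (∃ i, ⇑φ = Rx i) ∨
    (∃ i j, i ≠ j ∧ ⇑φ = Rzz i j) ∨ (∃ i j, i ≠ j ∧ ⇑φ = Rzx i j)}

@[simp] theorem aIx_inj {i j : Fin g} : aIx i = aIx j ↔ i = j := by simp [aIx]
@[simp] theorem bIx_inj {i j : Fin g} : bIx i = bIx j ↔ i = j := by simp [bIx]
@[simp] theorem cIx_inj {i j : Fin g} : cIx i = cIx j ↔ i = j := by simp [cIx]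
@[simp] theorem dIx_inj {i j : Fin g} : dIx i = dIx j ↔ i = j := by simp [dIx]
@[simp] theorem aIx_ne_bIx {i j : Fin g} : aIx i ≠ bIx j := by simp [aIx, bIx]
@[simp] theorem aIx_ne_cIx {i j : Fin g} : aIx i ≠ cIx j := by simp [aIx, cIx]
@[simp] theorem aIx_ne_dIx {i j : Fin g} : aIx i ≠ dIx j := by simp [aIx, dIx]
@[simp] theorem bIx_ne_aIx {i j : Fin g} : bIx i ≠ aIx j := aIx_ne_bIx.symm
@[simp] theorem bIx_ne_cIx {i j : Fin g} : bIx i ≠ cIx j := by simp [bIx, cIx]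
@[simp] theorem bIx_ne_dIx {i j : Fin g} : bIx i ≠ dIx j := by simp [bIx, dIx]
@[simp] theorem cIx_ne_aIx {i j : Fin g} : cIx i ≠ aIx j := aIx_ne_cIx.symm
@[simp] theorem cIx_ne_bIx {i j : Fin g} : cIx i ≠ bIx j := bIx_ne_cIx.symm
@[simp] theorem cIx_ne_dIx {i j : Fin g} : cIx i ≠ dIx j := by simp [cIx, dIx]
@[simp] theorem dIx_ne_aIx {i j : Fin g} : dIx i ≠ aIx j := aIx_ne_dIx.symm
@[simp] theorem dIx_ne_bIx {i j : Fin g} : dIx i ≠ bIx j := bIx_ne_dIx.symm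
@[simp] theorem dIx_ne_cIx {i j : Fin g} : dIx i ≠ cIx j := cIx_ne_dIx.symm

/-- `R_{z_i}` as an element of `GL(H)`. -/
def RzEquiv (i : Fin g) : Hmod g ≃ₗ[ℤ] Hmod g where
  toFun := Rz i
  map_add' σ τ := by
    funext k; simp only [Rz, Pi.add_apply]; split_ifs <;> ring
  map_smul' m σ := by
    funext k; simp only [Rz, Pi.smul_apply, smul_eq_mul, RingHom.id_apply]; split_ifs <;> ring
  invFun σ k :=
    if k = bIx i then σ (bIx i) + σ (cIx i)
    else if k = dIx i then σ (dIx i) - σ (aIx i)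
    else σ k
  left_inv σ := by
    funext k; simp only [Rz]; split_ifs <;> simp_all
  right_inv σ := by
    funext k; simp only [Rz]; split_ifs <;> simp_all

/-- `R_{x_i}` as an element of `GL(H)`. -/
def RxEquiv (i : Fin g) : Hmod g ≃ₗ[ℤ] Hmod g where
  toFun := Rx i
  map_add' σ τ := by
    funext k; simp only [Rx, Pi.add_apply]; split_ifs <;> ring
  map_smul' m σ := by
    funext k; simp only [Rx, Pi.smul_apply, smul_eq_mul, RingHom.id_apply]; split_ifs <;> ring
  invFun σ k :=
    if k = aIx i then σ (aIx i) + σ (dIx i)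
    else if k = cIx i then σ (cIx i) - σ (bIx i)
    else σ k
  left_inv σ := by
    funext k; simp only [Rx]; split_ifs <;> simp_all
  right_inv σ := by
    funext k; simp only [Rx]; split_ifs <;> simp_all

/-- `R_{z_i+x_j}` (`i ≠ j`) as an element of `GL(H)`. -/
def RzxEquiv (i j : Fin g) (hij : i ≠ j) : Hmod g ≃ₗ[ℤ] Hmod g where
  toFun := Rzx i j
  map_add' σ τ := by
    funext k; simp only [Rzx, Pi.add_apply]; split_ifs <;> ring
  map_smul' m σ := by
    funext k; simp only [Rzx, Pi.smul_apply, smul_eq_mul, RingHom.id_apply]; split_ifs <;> ring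
  invFun σ k :=
    if k = bIx i then σ (bIx i) + σ (cIx i) - σ (bIx j)
    else if k = dIx i then σ (dIx i) - σ (aIx i) - σ (dIx j)
    else if k = aIx j then σ (aIx j) + σ (aIx i) + σ (dIx j)
    else if k = cIx j then σ (cIx j) + σ (cIx i) - σ (bIx j)
    else σ k
  left_inv σ := by
    funext k; simp only [Rzx]; simp [hij, hij.symm]; split_ifs <;> simp_all <;> ring
  right_inv σ := by
    funext k; simp only [Rzx]; simp [hij, hij.symm]; split_ifs <;> simp_all <;> ring

/-- The handle slide `R_{x_j}⁻¹ R_{z_i}⁻¹ R_{z_i+x_j}`, which acts by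
`b_i ↦ b_i + b_j`, `d_i ↦ d_i + d_j`, `a_j ↦ a_j - a_i`, `c_j ↦ c_j - c_i`. -/
def slide (i j : Fin g) (hij : i ≠ j) : Hmod g ≃ₗ[ℤ] Hmod g :=
  (RxEquiv j)⁻¹ * ((RzEquiv i)⁻¹ * RzxEquiv i j hij)

theorem RzEquiv_mem (i : Fin g) : RzEquiv i ∈ Subgroup.closure (dehnGens g) :=
  Subgroup.subset_closure (Or.inl ⟨i, rfl⟩)

theorem RxEquiv_mem (i : Fin g) : RxEquiv i ∈ Subgroup.closure (dehnGens g) :=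
  Subgroup.subset_closure (Or.inr (Or.inl ⟨i, rfl⟩))

theorem slide_mem (i j : Fin g) (hij : i ≠ j) :
    slide i j hij ∈ Subgroup.closure (dehnGens g) :=
  mul_mem (inv_mem (RxEquiv_mem j)) (mul_mem (inv_mem (RzEquiv_mem i))
    (Subgroup.subset_closure (Or.inr (Or.inr (Or.inr ⟨i, j, hij, rfl⟩)))))

theorem RzEquiv_apply_a (i k : Fin g) (σ : Hmod g) : RzEquiv i σ (aIx k) = σ (aIx k) := by
  simp [RzEquiv, Rz]

theorem RzEquiv_apply_b (i k : Fin g) (σ : Hmod g) :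
    RzEquiv i σ (bIx k) = if k = i then σ (bIx i) - σ (cIx i) else σ (bIx k) := by
  simp [RzEquiv, Rz]

theorem RzEquiv_apply_c (i k : Fin g) (σ : Hmod g) : RzEquiv i σ (cIx k) = σ (cIx k) := by
  simp [RzEquiv, Rz]

theorem RzEquiv_apply_d (i k : Fin g) (σ : Hmod g) :
    RzEquiv i σ (dIx k) = if k = i then σ (dIx i) + σ (aIx i) else σ (dIx k) := by
  simp [RzEquiv, Rz]

theorem RxEquiv_apply_a (i k : Fin g) (σ : Hmod g) :
    RxEquiv i σ (aIx k) = if k = i then σ (aIx i) - σ (dIx i) else σ (aIx k) := by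
  simp [RxEquiv, Rx]

theorem RxEquiv_apply_b (i k : Fin g) (σ : Hmod g) : RxEquiv i σ (bIx k) = σ (bIx k) := by
  simp [RxEquiv, Rx]

theorem RxEquiv_apply_c (i k : Fin g) (σ : Hmod g) :
    RxEquiv i σ (cIx k) = if k = i then σ (cIx i) + σ (bIx i) else σ (cIx k) := by
  simp [RxEquiv, Rx]

theorem RxEquiv_apply_d (i k : Fin g) (σ : Hmod g) : RxEquiv i σ (dIx k) = σ (dIx k) := by
  simp [RxEquiv, Rx]

theorem slide_apply_a (i j k : Fin g) (hij : i ≠ j) (σ : Hmod g) :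
    slide i j hij σ (aIx k) = if k = j then σ (aIx j) - σ (aIx i) else σ (aIx k) := by
  change (RxEquiv j).symm ((RzEquiv i).symm (Rzx i j σ)) _ = _
  simp [RxEquiv, RzEquiv, Rzx, hij, hij.symm]
  split_ifs <;> rfl

theorem slide_apply_d (i j k : Fin g) (hij : i ≠ j) (σ : Hmod g) :
    slide i j hij σ (dIx k) = if k = i then σ (dIx i) + σ (dIx j) else σ (dIx k) := by
  change (RxEquiv j).symm ((RzEquiv i).symm (Rzx i j σ)) _ = _
  simp [RxEquiv, RzEquiv, Rzx, hij]
  split_ifs <;> ring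

/-- Euclid's algorithm: if `A` adds the coordinate `f` to `h` and `B` subtracts `h` from `f`,
then words in `A` and `B` can make `h` vanish, preserving any property invariant under both. -/
theorem exists_mem_eq_zero {M : Type*} [AddCommGroup M] (K : Subgroup (M ≃ₗ[ℤ] M))
    {A B : M ≃ₗ[ℤ] M} (hA : A ∈ K) (hB : B ∈ K) (f h : M → ℤ) (I : M → Prop)
    (hAI : ∀ σ, I (A σ) ↔ I σ) (hBI : ∀ σ, I (B σ) ↔ I σ)
    (hAh : ∀ σ, h (A σ) = h σ + f σ) (hAf : ∀ σ, f (A σ) = f σ)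
    (hBf : ∀ σ, f (B σ) = f σ - h σ) (hBh : ∀ σ, h (B σ) = h σ)
    (σ : M) (hσ : I σ) : ∃ φ ∈ K, I (φ σ) ∧ h (φ σ) = 0 := by
  induction hn : (h σ).natAbs + (f σ).natAbs using Nat.strong_induction_on generalizing σ with
  | _ n ih =>
  subst hn
  have step : ∀ C ∈ K, I (C σ) →
      (h (C σ)).natAbs + (f (C σ)).natAbs < (h σ).natAbs + (f σ).natAbs →
      ∃ φ ∈ K, I (φ σ) ∧ h (φ σ) = 0 := fun C hC hI hlt => by
    obtain ⟨φ, hφ, h₁, h₂⟩ := ih _ hlt (C σ) hI rfl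
    exact ⟨φ * C, mul_mem hφ hC, h₁, h₂⟩
  have hA' : A (A⁻¹ σ) = σ := A.apply_symm_apply σ
  have hB' : B (B⁻¹ σ) = σ := B.apply_symm_apply σ
  have e₁ := hAI (A⁻¹ σ)
  have e₂ := hAh (A⁻¹ σ)
  have e₃ := hAf (A⁻¹ σ)
  have e₄ := hBI (B⁻¹ σ)
  have e₅ := hBf (B⁻¹ σ)
  have e₆ := hBh (B⁻¹ σ)
  rw [hA'] at e₁ e₂ e₃
  rw [hB'] at e₄ e₅ e₆
  have sA := step A hA ((hAI σ).2 hσ)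
  have sA' := step A⁻¹ (inv_mem hA) (e₁.1 hσ)
  have sB := step B hB ((hBI σ).2 hσ)
  have sB' := step B⁻¹ (inv_mem hB) (e₄.1 hσ)
  rw [hAh, hAf] at sA
  rw [hBh, hBf] at sB
  by_cases h0 : h σ = 0
  · exact ⟨1, one_mem K, hσ, h0⟩
  by_cases f0 : f σ = 0
  · refine ⟨A * B, mul_mem hA hB, (hAI _).2 ((hBI _).2 hσ), ?_⟩
    change h (A (B σ)) = 0
    rw [hAh, hBh, hBf]
    omega
  by_cases c₁ : (h σ + f σ).natAbs < (h σ).natAbs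
  · exact sA (by omega)
  by_cases c₂ : (h σ - f σ).natAbs < (h σ).natAbs
  · exact sA' (by omega)
  by_cases c₃ : (f σ - h σ).natAbs < (f σ).natAbs
  · exact sB (by omega)
  · exact sB' (by omega)

/-- Conditions indexed by a finite type can be achieved one at a time if each of them can be
achieved without destroying the ones already achieved. -/
theorem exists_mem_forall {M ι : Type*} [AddCommGroup M] [Fintype ι] [DecidableEq ι]
    (K : Subgroup (M ≃ₗ[ℤ] M)) (I : M → Prop) (P : ι → M → Prop)
    (step : ∀ (i : ι) (s : Finset ι), i ∉ s → ∀ σ, I σ ∧ (∀ k ∈ s, P k σ) →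
      ∃ φ ∈ K, (I (φ σ) ∧ ∀ k ∈ s, P k (φ σ)) ∧ P i (φ σ))
    (σ : M) (hσ : I σ) : ∃ φ ∈ K, I (φ σ) ∧ ∀ k, P k (φ σ) := by
  suffices ∀ s : Finset ι, ∃ φ ∈ K, I (φ σ) ∧ ∀ k ∈ s, P k (φ σ) by
    simpa using this Finset.univ
  intro s
  induction s using Finset.induction_on with
  | empty => exact ⟨1, one_mem K, hσ, by simp⟩
  | insert i s hi ih =>
    obtain ⟨φ, hφ, h⟩ := ih
    obtain ⟨ψ, hψ, h₁, h₂⟩ := step i s hi (φ σ) h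
    exact ⟨ψ * φ, mul_mem hψ hφ, h₁.1, (Finset.forall_mem_insert _ _ _).2 ⟨h₂, h₁.2⟩⟩

/-- All coordinates `d_k` can be made zero. -/
theorem exists_forall_d_eq_zero (σ : Hmod g) :
    ∃ φ ∈ Subgroup.closure (dehnGens g), ∀ k, φ σ (dIx k) = 0 := by
  obtain ⟨φ, hφ, -, h⟩ := exists_mem_forall (Subgroup.closure (dehnGens g)) (fun _ => True)
    (fun k τ => τ (dIx k) = 0) (fun i s hi τ hτ =>
      exists_mem_eq_zero _ (RzEquiv_mem i) (RxEquiv_mem i) (fun τ => τ (aIx i))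
        (fun τ => τ (dIx i)) (fun τ => True ∧ ∀ k ∈ s, τ (dIx k) = 0)
        (fun τ => by simp only [RzEquiv_apply_d]; grind)
        (fun τ => by simp only [RxEquiv_apply_d])
        (fun τ => by simp [RzEquiv_apply_d]) (fun τ => by simp [RzEquiv_apply_a])
        (fun τ => by simp [RxEquiv_apply_a]) (fun τ => by simp [RxEquiv_apply_d])
        τ hτ) σ trivial
  exact ⟨φ, hφ, h⟩

/-- If all `d_k` vanish, then handle slides make all `a_k` with `k ≠ o` vanish as well. -/
theorem exists_forall_a_eq_zero (o : Fin g) (σ : Hmod g) (hσ : ∀ k, σ (dIx k) = 0) :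
    ∃ φ ∈ Subgroup.closure (dehnGens g), (∀ k, φ σ (dIx k) = 0) ∧
      ∀ k, k ≠ o → φ σ (aIx k) = 0 := by
  refine exists_mem_forall _ (fun τ => ∀ k, τ (dIx k) = 0)
    (fun k τ => k ≠ o → τ (aIx k) = 0) (fun i s hi τ hτ => ?_) σ hσ
  by_cases hio : i = o
  · exact ⟨1, one_mem _, hτ, fun h => absurd hio h⟩
  have hinv (τ : Hmod g) : slide i o hio ((slide i o hio)⁻¹ τ) = τ :=
    (slide i o hio).apply_symm_apply τ
  have hslide (p q : Fin g) (hpq : p ≠ q) (hq : q ∉ s ∨ q = o) (τ : Hmod g) :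
      ((∀ k, slide p q hpq τ (dIx k) = 0) ∧ ∀ k ∈ s, k ≠ o → slide p q hpq τ (aIx k) = 0) ↔
        ((∀ k, τ (dIx k) = 0) ∧ ∀ k ∈ s, k ≠ o → τ (aIx k) = 0) := by
    simp only [slide_apply_d, slide_apply_a]
    refine and_congr ⟨fun h k => ?_, fun h k => ?_⟩ ?_
    · have h₁ := h k
      have h₂ := h q
      grind
    · grind
    · grind
  obtain ⟨φ, hφ, h₁, h₂⟩ := exists_mem_eq_zero (Subgroup.closure (dehnGens g))
    (slide_mem o i (Ne.symm hio)) (inv_mem (slide_mem i o hio))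
    (fun τ => -τ (aIx o)) (fun τ => τ (aIx i))
    (fun τ => (∀ k, τ (dIx k) = 0) ∧ ∀ k ∈ s, k ≠ o → τ (aIx k) = 0)
    (hslide o i _ (Or.inl hi))
    (fun τ => by
      have h := hslide i o hio (Or.inr rfl) ((slide i o hio)⁻¹ τ)
      rw [hinv] at h
      exact h.symm)
    (fun τ => by simp [slide_apply_a, sub_eq_add_neg])
    (fun τ => by simp [slide_apply_a, Ne.symm hio])
    (fun τ => by
      have h := slide_apply_a i o o hio ((slide i o hio)⁻¹ τ)
      have h' := slide_apply_a i o i hio ((slide i o hio)⁻¹ τ)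
      rw [hinv] at h h'
      simp only [hio, if_true, if_false] at h h'
      linarith)
    (fun τ => by
      have h := slide_apply_a i o i hio ((slide i o hio)⁻¹ τ)
      rw [hinv] at h
      simpa [hio] using h.symm)
    τ hτ
  exact ⟨φ, hφ, h₁, fun _ => h₂⟩

/-- If all `d_k`, and all `a_k` with `k ≠ o`, vanish, then all `b_k` with `k ≠ o` can be made
zero without disturbing the `d_k`. -/
theorem exists_forall_b_eq_zero (o : Fin g) (σ : Hmod g)
    (hσ : (∀ k, σ (dIx k) = 0) ∧ ∀ k, k ≠ o → σ (aIx k) = 0) :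
    ∃ φ ∈ Subgroup.closure (dehnGens g),
      ((∀ k, φ σ (dIx k) = 0) ∧ ∀ k, k ≠ o → φ σ (aIx k) = 0) ∧
      ∀ k, k ≠ o → φ σ (bIx k) = 0 := by
  refine exists_mem_forall _
    (fun τ => (∀ k, τ (dIx k) = 0) ∧ ∀ k, k ≠ o → τ (aIx k) = 0)
    (fun k τ => k ≠ o → τ (bIx k) = 0) (fun i s hi τ hτ => ?_) σ hσ
  by_cases hio : i = o
  · exact ⟨1, one_mem _, hτ, fun h => absurd hio h⟩
  obtain ⟨φ, hφ, h₁, h₂⟩ := exists_mem_eq_zero (Subgroup.closure (dehnGens g))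
    (RzEquiv_mem i) (RxEquiv_mem i) (fun τ => -τ (cIx i)) (fun τ => τ (bIx i))
    (fun τ => ((∀ k, τ (dIx k) = 0) ∧ ∀ k, k ≠ o → τ (aIx k) = 0) ∧
      ∀ k ∈ s, k ≠ o → τ (bIx k) = 0)
    (fun τ => by
      simp only [RzEquiv_apply_a, RzEquiv_apply_b, RzEquiv_apply_d]
      grind)
    (fun τ => by
      simp only [RxEquiv_apply_a, RxEquiv_apply_b, RxEquiv_apply_d]
      grind)
    (fun τ => by simp [RzEquiv_apply_b, sub_eq_add_neg]) (fun τ => by simp [RzEquiv_apply_c])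
    (fun τ => by simp [RxEquiv_apply_c]; ring) (fun τ => by simp [RxEquiv_apply_b])
    τ hτ
  exact ⟨φ, hφ, h₁, fun _ => h₂⟩

/-- Lemma 1, algebraic form: every `σ ∈ H` can be moved by an element
of the subgroup of `GL(H)` generated by the `R`-maps to a class with `b_i = d_i = 0`
for all `i ≥ 2` (blocks are indexed `0, …, g-1` here, so this reads `i ≥ 1`). -/
theorem statement1 (g : ℕ) (hg : 1 ≤ g) (σ : Hmod g) :
    ∃ φ ∈ Subgroup.closure (dehnGens g), ∀ i : Fin g, 1 ≤ (i : ℕ) →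
      φ σ (bIx i) = 0 ∧ φ σ (dIx i) = 0 := by
  let o : Fin g := ⟨0, hg⟩
  obtain ⟨φ, hφ, h₁⟩ := exists_forall_d_eq_zero σ
  obtain ⟨ψ, hψ, h₂⟩ := exists_forall_a_eq_zero o (φ σ) h₁
  obtain ⟨χ, hχ, ⟨h₃, -⟩, h₄⟩ := exists_forall_b_eq_zero o (ψ (φ σ)) h₂
  refine ⟨χ * (ψ * φ), mul_mem hχ (mul_mem hψ hφ), fun i hi => ⟨h₄ i ?_, h₃ i⟩⟩
  rintro rfl
  exact absurd hi (by simp [o])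

end MinGenusT2
end

section
/- (Lemma 2, algebraic form.) For every σ ∈ H = ℤ^{4g+2} there exists an element φ of the subgroup of GL(H) generated by the maps R_{z_i}, R_{x_i}, R_{z_i+z_j}, R_{z_i+x_j} (for all 1 ≤ i, j ≤ g with i ≠ j), D_{x_1y}, f_y, and f_t such that, writing τ = φ(σ): b_i(τ) = d_i(τ) = 0 for every i with 2 ≤ i ≤ g, c_1(τ) = d_1(τ) = 0, a_1(τ) divides b_1(τ), and a_1(τ) divides e(τ). -/
/-!
Model for `H₂(Σ_g × T²) ≅ ℤ^(4g+2)`: index set `(Fin g × Fin 4) ⊕ Fin 2`,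
where for a block `i`, the four coordinates `(i,0), (i,1), (i,2), (i,3)` are
`a_i, b_i, c_i, d_i`, and `Sum.inr 0`, `Sum.inr 1` are `e`, `f`.
Blocks are indexed `0, …, g-1` (corresponding to `1, …, g` in the paper).
-/

namespace MinGenusT2

variable {g : ℕ}

/-- The generating set for Lemma 2: the Dehn-twist maps `R_{z_i}`, `R_{x_i}`,
`R_{z_i+z_j}`, `R_{z_i+x_j}` (`i ≠ j`) together with `D_{x_1y}`, `f_y` and `f_t`,
as elements of `GL(H)`. Blocks are indexed `0, …, g-1`, so `x_1, z_1` is block `0`. -/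
def lemma2Gens (g : ℕ) (hg : 0 < g) : Set (Hmod g ≃ₗ[ℤ] Hmod g) :=
  {φ | (∃ i, ⇑φ = Rz i) ∨ (∃ i, ⇑φ = Rx i) ∨
    (∃ i j, i ≠ j ∧ ⇑φ = Rzz i j) ∨ (∃ i j, i ≠ j ∧ ⇑φ = Rzx i j) ∨
    ⇑φ = Dxy (⟨0, hg⟩ : Fin g) ∨ ⇑φ = fy ∨ ⇑φ = ft}

/-- The orbit of `σ` under the subgroup generated by `lemma2Gens`. -/
def lemmaOrbit (hg : 0 < g) (σ : Hmod g) : Set (Hmod g) :=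
  {τ | ∃ φ ∈ Subgroup.closure (lemma2Gens g hg), φ σ = τ}

/-- The `k`-th power of a unipotent map `f` with `(f - 1)² = 0`. -/
def shear (f : Hmod g → Hmod g) (k : ℤ) (τ : Hmod g) : Hmod g := τ + k • (f τ - τ)

/-- A linear map `f` with `(f - 1)² = 0`, as a linear automorphism. -/
def unipotentEquiv (f : Hmod g → Hmod g) (hadd : ∀ σ τ, f (σ + τ) = f σ + f τ)
    (hsq : ∀ σ, f (f σ - σ) = f σ - σ) : Hmod g ≃ₗ[ℤ] Hmod g :=
  let F : Hmod g →ₗ[ℤ] Hmod g := (AddMonoidHom.mk' f hadd).toIntLinearMap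
  have hF : ∀ σ, F (F σ) = F σ + (F σ - σ) := fun σ => by
    have h : F (F σ - σ) = F σ - σ := hsq σ
    rw [map_sub] at h
    rw [← h]
    abel
  LinearEquiv.ofLinearMap F (LinearMap.id + (LinearMap.id - F))
    (by
      apply LinearMap.ext
      intro σ
      simp only [LinearMap.comp_apply, LinearMap.add_apply, LinearMap.sub_apply,
        LinearMap.id_apply, map_add, map_sub, hF]
      abel)
    (by
      apply LinearMap.ext
      intro σ
      simp only [LinearMap.comp_apply, LinearMap.add_apply, LinearMap.sub_apply,
        LinearMap.id_apply, hF]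
      abel)

theorem shear_mem_lemmaOrbit {hg : 0 < g} {σ : Hmod g} (f : Hmod g → Hmod g)
    (hadd : ∀ σ τ, f (σ + τ) = f σ + f τ) (hsq : ∀ σ, f (f σ - σ) = f σ - σ)
    (hgen : ∀ φ : Hmod g ≃ₗ[ℤ] Hmod g, ⇑φ = f → φ ∈ lemma2Gens g hg) (k : ℤ)
    {τ : Hmod g} (hτ : τ ∈ lemmaOrbit hg σ) : shear f k τ ∈ lemmaOrbit hg σ := by
  obtain ⟨ψ, hψ, rfl⟩ := hτ
  set φ := unipotentEquiv f hadd hsq with hφ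
  have hφf : ∀ σ, φ σ = f σ := fun _ => rfl
  have hmem : φ ∈ Subgroup.closure (lemma2Gens g hg) :=
    Subgroup.subset_closure (hgen φ (funext hφf))
  have hstep : ∀ (k : ℤ) (τ : Hmod g), φ (shear f k τ) = shear f (k + 1) τ := by
    intro k τ
    have h : φ (φ τ - τ) = φ τ - τ := hsq τ
    simp only [shear, ← hφf]
    rw [map_add, map_zsmul, h, add_smul, one_smul]
    abel
  induction k using Int.induction_on with
  | zero => exact ⟨ψ, hψ, by simp [shear]⟩
  | succ n ih =>
    obtain ⟨χ, hχ, h⟩ := ih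
    exact ⟨φ * χ, mul_mem hmem hχ, by rw [LinearEquiv.mul_apply, h, hstep]⟩
  | pred n ih =>
    obtain ⟨χ, hχ, h⟩ := ih
    refine ⟨φ⁻¹ * χ, mul_mem (inv_mem hmem) hχ, ?_⟩
    rw [LinearEquiv.mul_apply, h]
    apply φ.injective
    rw [hstep, sub_add_cancel]
    exact φ.apply_symm_apply _

section Coordinates

variable (i j l : Fin g) (k : ℤ) (τ : Hmod g)

theorem shear_Rz_a : shear (Rz i) k τ (aIx l) = τ (aIx l) := by
  simp [shear, Rz, aIx, bIx, dIx]

theorem shear_Rz_b : shear (Rz i) k τ (bIx l) =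
    if l = i then τ (bIx i) - k * τ (cIx i) else τ (bIx l) := by
  by_cases h : l = i <;> simp [shear, Rz, bIx, dIx, h]
  ring

theorem shear_Rz_c : shear (Rz i) k τ (cIx l) = τ (cIx l) := by
  simp [shear, Rz, cIx, bIx, dIx]

theorem shear_Rz_d : shear (Rz i) k τ (dIx l) =
    if l = i then τ (dIx i) + k * τ (aIx i) else τ (dIx l) := by
  by_cases h : l = i <;> simp [shear, Rz, bIx, dIx, h]

theorem shear_Rx_a : shear (Rx i) k τ (aIx l) =
    if l = i then τ (aIx i) - k * τ (dIx i) else τ (aIx l) := by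
  by_cases h : l = i <;> simp [shear, Rx, aIx, cIx, h]
  ring

theorem shear_Rx_b : shear (Rx i) k τ (bIx l) = τ (bIx l) := by
  simp [shear, Rx, aIx, bIx, cIx]

theorem shear_Rx_c : shear (Rx i) k τ (cIx l) =
    if l = i then τ (cIx i) + k * τ (bIx i) else τ (cIx l) := by
  by_cases h : l = i <;> simp [shear, Rx, aIx, cIx, h]

theorem shear_Rx_d : shear (Rx i) k τ (dIx l) = τ (dIx l) := by
  simp [shear, Rx, aIx, dIx, cIx]

theorem shear_Rzz_a : shear (Rzz i j) k τ (aIx l) = τ (aIx l) := by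
  simp [shear, Rzz, aIx, bIx, dIx]

theorem shear_Rzz_b : shear (Rzz i j) k τ (bIx l) =
    if l = i ∨ l = j then τ (bIx l) - k * (τ (cIx i) + τ (cIx j)) else τ (bIx l) := by
  by_cases h : l = i
  · subst h
    simp [shear, Rzz]
    ring
  · by_cases h' : l = j
    · subst h'
      simp [shear, Rzz, bIx, dIx, h]
      ring
    · simp [shear, Rzz, bIx, dIx, h, h']

theorem shear_Rzz_c : shear (Rzz i j) k τ (cIx l) = τ (cIx l) := by
  simp [shear, Rzz, cIx, bIx, dIx]

theorem shear_Rzz_d : shear (Rzz i j) k τ (dIx l) =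
    if l = i ∨ l = j then τ (dIx l) + k * (τ (aIx i) + τ (aIx j)) else τ (dIx l) := by
  by_cases h : l = i
  · subst h
    simp [shear, Rzz, bIx, dIx, add_assoc]
  · by_cases h' : l = j
    · subst h'
      simp [shear, Rzz, bIx, dIx, h, add_assoc]
    · simp [shear, Rzz, bIx, dIx, h, h']

theorem shear_fy_a : shear fy k τ (aIx l) = τ (aIx l) := by simp [shear, fy, aIx]

theorem shear_fy_c : shear fy k τ (cIx l) = τ (cIx l) + k * τ (aIx l) := by
  simp [shear, fy, cIx]

theorem shear_fy_d : shear fy k τ (dIx l) = τ (dIx l) := by simp [shear, fy, dIx]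

theorem shear_ft_a : shear ft k τ (aIx l) = τ (aIx l) + k * τ (cIx l) := by
  simp [shear, ft, aIx]

theorem shear_ft_c : shear ft k τ (cIx l) = τ (cIx l) := by simp [shear, ft, cIx]

theorem shear_ft_d : shear ft k τ (dIx l) = τ (dIx l) - k * τ (bIx l) := by
  simp [shear, ft, dIx]
  ring

theorem shear_Dxy_a : shear (Dxy i) k τ (aIx l) = τ (aIx l) := by
  simp [shear, Dxy, aIx, dIx, fIx]

theorem shear_Dxy_d : shear (Dxy i) k τ (dIx i) = τ (dIx i) + k * τ eIx := by
  simp [shear, Dxy]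

end Coordinates

section Orbit

variable {hg : 0 < g} {σ τ : Hmod g}

theorem Rz_mem (i : Fin g) (k : ℤ) (hτ : τ ∈ lemmaOrbit hg σ) :
    shear (Rz i) k τ ∈ lemmaOrbit hg σ := by
  refine shear_mem_lemmaOrbit _ ?_ ?_ (fun φ h => Or.inl ⟨i, h⟩) k hτ
  · intro σ τ
    ext x
    simp only [Rz, Pi.add_apply]
    split_ifs <;> ring
  · intro σ
    ext x
    simp only [Rz, Pi.sub_apply]
    split_ifs <;> simp_all [aIx, bIx, cIx, dIx]

theorem Rx_mem (i : Fin g) (k : ℤ) (hτ : τ ∈ lemmaOrbit hg σ) :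
    shear (Rx i) k τ ∈ lemmaOrbit hg σ := by
  refine shear_mem_lemmaOrbit _ ?_ ?_ (fun φ h => Or.inr (Or.inl ⟨i, h⟩)) k hτ
  · intro σ τ
    ext x
    simp only [Rx, Pi.add_apply]
    split_ifs <;> ring
  · intro σ
    ext x
    simp only [Rx, Pi.sub_apply]
    split_ifs <;> simp_all [aIx, bIx, cIx, dIx]

theorem Rzz_mem {i j : Fin g} (hij : i ≠ j) (k : ℤ) (hτ : τ ∈ lemmaOrbit hg σ) :
    shear (Rzz i j) k τ ∈ lemmaOrbit hg σ := by
  refine shear_mem_lemmaOrbit _ ?_ ?_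
    (fun φ h => Or.inr (Or.inr (Or.inl ⟨i, j, hij, h⟩))) k hτ
  · intro σ τ
    ext x
    simp only [Rzz, Pi.add_apply]
    split_ifs <;> ring
  · intro σ
    have ha : ∀ l, (Rzz i j σ - σ) (aIx l) = 0 := by simp [Rzz, aIx, bIx, dIx]
    have hc : ∀ l, (Rzz i j σ - σ) (cIx l) = 0 := by simp [Rzz, cIx, bIx, dIx]
    generalize Rzz i j σ - σ = ν at ha hc ⊢
    ext x
    simp only [Rzz, ha, hc]
    split_ifs <;> simp_all

theorem Dxy_mem (k : ℤ) (hτ : τ ∈ lemmaOrbit hg σ) :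
    shear (Dxy ⟨0, hg⟩) k τ ∈ lemmaOrbit hg σ := by
  refine shear_mem_lemmaOrbit _ ?_ ?_
    (fun φ h => Or.inr (Or.inr (Or.inr (Or.inr (Or.inl h))))) k hτ
  · intro σ τ
    ext x
    simp only [Dxy, Pi.add_apply]
    split_ifs <;> ring
  · intro σ
    ext x
    simp only [Dxy, Pi.sub_apply]
    split_ifs <;> simp_all [cIx, dIx, eIx, fIx]

theorem fy_mem (k : ℤ) (hτ : τ ∈ lemmaOrbit hg σ) : shear fy k τ ∈ lemmaOrbit hg σ := by
  refine shear_mem_lemmaOrbit _ ?_ ?_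
    (fun φ h => Or.inr (Or.inr (Or.inr (Or.inr (Or.inr (Or.inl h)))))) k hτ
  · intro σ τ
    ext x
    rcases x with ⟨i, q⟩ | r
    · simp only [fy, Pi.add_apply]
      split_ifs <;> ring
    · rfl
  · intro σ
    ext x
    rcases x with ⟨i, q⟩ | r
    · fin_cases q <;> simp [fy, aIx, bIx, cIx, dIx]
    · rfl

theorem ft_mem (k : ℤ) (hτ : τ ∈ lemmaOrbit hg σ) : shear ft k τ ∈ lemmaOrbit hg σ := by
  refine shear_mem_lemmaOrbit _ ?_ ?_
    (fun φ h => Or.inr (Or.inr (Or.inr (Or.inr (Or.inr (Or.inr h)))))) k hτ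
  · intro σ τ
    ext x
    rcases x with ⟨i, q⟩ | r
    · simp only [ft, Pi.add_apply]
      split_ifs <;> ring
    · rfl
  · intro σ
    ext x
    rcases x with ⟨i, q⟩ | r
    · fin_cases q <;> simp [ft, aIx, bIx, cIx, dIx]
    · rfl

/-- `ρ` and `τ` have the same `a, b, c, d` coordinates in block `l`. -/
def SameBlock (ρ τ : Hmod g) (l : Fin g) : Prop :=
  ρ (aIx l) = τ (aIx l) ∧ ρ (bIx l) = τ (bIx l) ∧ ρ (cIx l) = τ (cIx l) ∧ ρ (dIx l) = τ (dIx l)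

/-- A quarter turn `(a, d) ↦ (-d, a)`, `(c, b) ↦ (b, -c)` in a single block. -/
theorem exists_rotate_block (i : Fin g) (hτ : τ ∈ lemmaOrbit hg σ) :
    ∃ ρ ∈ lemmaOrbit hg σ, ρ (aIx i) = -τ (dIx i) ∧ ρ (dIx i) = τ (aIx i) ∧
      ρ (cIx i) = τ (bIx i) ∧ ρ (bIx i) = -τ (cIx i) ∧ ∀ l ≠ i, SameBlock ρ τ l := by
  refine ⟨_, Rz_mem i 1 (Rx_mem i 1 (Rz_mem i 1 hτ)), ?_⟩
  simp +contextual [SameBlock, shear_Rz_a, shear_Rz_b, shear_Rz_c, shear_Rz_d, shear_Rx_a,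
    shear_Rx_b, shear_Rx_c, shear_Rx_d]

/-- The mixed shear `d_i += k a_j`, `d_j += k a_i`, `b_i -= k c_j`, `b_j -= k c_i`. -/
theorem exists_mixed_shear {i j : Fin g} (hij : i ≠ j) (k : ℤ) (hτ : τ ∈ lemmaOrbit hg σ) :
    ∃ ρ ∈ lemmaOrbit hg σ,
      (∀ l, ρ (aIx l) = τ (aIx l)) ∧ (∀ l, ρ (cIx l) = τ (cIx l)) ∧
      ρ (dIx i) = τ (dIx i) + k * τ (aIx j) ∧ ρ (dIx j) = τ (dIx j) + k * τ (aIx i) ∧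
      ρ (bIx i) = τ (bIx i) - k * τ (cIx j) ∧ ρ (bIx j) = τ (bIx j) - k * τ (cIx i) ∧
      ∀ l, l ≠ i → l ≠ j → SameBlock ρ τ l := by
  refine ⟨_, Rz_mem i (-k) (Rz_mem j (-k) (Rzz_mem hij k hτ)), ?_⟩
  simp +contextual [SameBlock, shear_Rz_a, shear_Rz_b, shear_Rz_c, shear_Rz_d, shear_Rzz_a,
    shear_Rzz_b, shear_Rzz_c, shear_Rzz_d, hij, hij.symm]
  refine ⟨?_, ?_, ?_, ?_⟩ <;> ring

/-- Euclid's algorithm on the pair `(c_i, b_i)` when `a_i = d_i = 0`. -/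
theorem exists_b_eq_zero (i : Fin g) (hτ : τ ∈ lemmaOrbit hg σ)
    (ha : τ (aIx i) = 0) (hd : τ (dIx i) = 0) :
    ∃ ρ ∈ lemmaOrbit hg σ, ρ (bIx i) = 0 ∧ ρ (dIx i) = 0 ∧ ∀ l ≠ i, SameBlock ρ τ l := by
  induction hn : (τ (bIx i)).natAbs using Nat.strong_induction_on generalizing τ with
  | _ n ih =>
    by_cases hb : τ (bIx i) = 0
    · exact ⟨τ, hτ, hb, hd, fun l _ => ⟨rfl, rfl, rfl, rfl⟩⟩
    obtain ⟨ρ, hρ, h1, h2, -, h4, h5⟩ :=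
      exists_rotate_block i (Rx_mem i (-(τ (cIx i) / τ (bIx i))) hτ)
    simp only [SameBlock, shear_Rx_a, shear_Rx_b, shear_Rx_c, shear_Rx_d, if_true] at h1 h2 h4 h5
    have hlt : (ρ (bIx i)).natAbs < n := by
      have h6 := Int.emod_nonneg (τ (cIx i)) hb
      have h7 := Int.emod_lt_abs (τ (cIx i)) hb
      have h8 : ρ (bIx i) = -(τ (cIx i) % τ (bIx i)) := by
        rw [h4, Int.emod_def]
        ring
      rw [← hn, ← Int.ofNat_lt, Int.natCast_natAbs, Int.natCast_natAbs, h8, abs_neg,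
        abs_of_nonneg h6]
      exact h7
    obtain ⟨ρ', hρ', hb', hd', hs⟩ := ih _ hlt hρ (by simp [h1, hd]) (by simp [h2, ha, hd]) rfl
    refine ⟨ρ', hρ', hb', hd', fun l hl => ?_⟩
    obtain ⟨e1, e2, e3, e4⟩ := hs l hl
    obtain ⟨f1, f2, f3, f4⟩ := h5 l hl
    rw [if_neg hl] at f1 f3
    exact ⟨e1.trans f1, e2.trans f2, e3.trans f3, e4.trans f4⟩

/-- The orbit contains a class whose `a_1` divides `d_1` and `c_1` of every class of the orbit
with the same `a_1`. -/
theorem exists_pivot (hg : 0 < g) (σ : Hmod g) :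
    ∃ τ ∈ lemmaOrbit hg σ, ∀ ρ ∈ lemmaOrbit hg σ, ρ (aIx ⟨0, hg⟩) = τ (aIx ⟨0, hg⟩) →
      τ (aIx ⟨0, hg⟩) ∣ ρ (dIx ⟨0, hg⟩) ∧ τ (aIx ⟨0, hg⟩) ∣ ρ (cIx ⟨0, hg⟩) := by
  set o : Fin g := ⟨0, hg⟩
  have hσ : σ ∈ lemmaOrbit hg σ := ⟨1, one_mem _, rfl⟩
  have key : ∃ τ ∈ lemmaOrbit hg σ, ∀ ρ ∈ lemmaOrbit hg σ,
      (τ (aIx o) = 0 ∨ |ρ (aIx o)| < |τ (aIx o)|) → ρ (aIx o) = 0 := by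
    by_cases h : ∃ τ ∈ lemmaOrbit hg σ, τ (aIx o) ≠ 0
    · obtain ⟨τ, ⟨hτ, hne⟩, hmin⟩ := WellFounded.has_min
        (measure fun τ : Hmod g => (τ (aIx o)).natAbs).wf
        {τ | τ ∈ lemmaOrbit hg σ ∧ τ (aIx o) ≠ 0} h
      refine ⟨τ, hτ, fun ρ hρ h' => by_contra fun hρ0 => hmin ρ ⟨hρ, hρ0⟩ ?_⟩
      change (ρ (aIx o)).natAbs < (τ (aIx o)).natAbs
      rw [← Int.ofNat_lt, Int.natCast_natAbs, Int.natCast_natAbs]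
      exact h'.resolve_left hne
    · push Not at h
      exact ⟨σ, hσ, fun ρ hρ _ => h ρ hρ⟩
  obtain ⟨τ, hτ, hmin⟩ := key
  have hdvd : ∀ x : ℤ, (∀ k : ℤ, ∃ ρ ∈ lemmaOrbit hg σ, ρ (aIx o) = -(x + k * τ (aIx o))) →
      τ (aIx o) ∣ x := by
    intro x hx
    obtain ⟨ρ, hρ, h⟩ := hx (-(x / τ (aIx o)))
    have h' : ρ (aIx o) = -(x % τ (aIx o)) := by
      rw [h, Int.emod_def]
      ring
    have h0 : ρ (aIx o) = 0 := by
      apply hmin ρ hρ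
      by_cases hz : τ (aIx o) = 0
      · exact Or.inl hz
      · right
        rw [h', abs_neg, abs_of_nonneg (Int.emod_nonneg _ hz)]
        exact Int.emod_lt_abs _ hz
    exact Int.dvd_of_emod_eq_zero (by omega)
  refine ⟨τ, hτ, fun ρ hρ ha => ⟨hdvd _ fun k => ?_, hdvd _ fun k => ?_⟩⟩
  · obtain ⟨ρ', hρ', h, -⟩ := exists_rotate_block o (Rz_mem o k hρ)
    exact ⟨ρ', hρ', by rw [h, shear_Rz_d, if_pos rfl, ha]⟩
  · refine ⟨_, ft_mem (-1) (fy_mem 1 (ft_mem (-1) (fy_mem k hρ))), ?_⟩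
    simp only [shear_ft_a, shear_ft_c, shear_fy_a, shear_fy_c, ha]
    ring

/-- If `c_1 = d_1 = 0` and `a_1` divides `a_i` and `d_i`, then `d_i` can be cleared. -/
theorem exists_clear_d {i : Fin g} (hi : (⟨0, hg⟩ : Fin g) ≠ i) (hτ : τ ∈ lemmaOrbit hg σ)
    (hc : τ (cIx ⟨0, hg⟩) = 0) (hd : τ (dIx ⟨0, hg⟩) = 0)
    (hai : τ (aIx ⟨0, hg⟩) ∣ τ (aIx i)) (hdi : τ (aIx ⟨0, hg⟩) ∣ τ (dIx i)) :
    ∃ ρ ∈ lemmaOrbit hg σ, ρ (aIx ⟨0, hg⟩) = τ (aIx ⟨0, hg⟩) ∧ ρ (cIx ⟨0, hg⟩) = 0 ∧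
      ρ (dIx ⟨0, hg⟩) = 0 ∧ ρ (aIx i) = τ (aIx i) ∧ ρ (dIx i) = 0 ∧
      ∀ l, l ≠ ⟨0, hg⟩ → l ≠ i → SameBlock ρ τ l := by
  obtain ⟨p, hp⟩ := hai
  obtain ⟨q, hq⟩ := hdi
  obtain ⟨ρ, hρ, h1, h2, h3, h4, -, -, h5⟩ := exists_mixed_shear hi (-q) hτ
  refine ⟨_, Rz_mem ⟨0, hg⟩ (q * p) hρ, ?_⟩
  simp only [SameBlock, shear_Rz_a, shear_Rz_b, shear_Rz_c, shear_Rz_d, if_true, h1, h2, h3, h4,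
    hc, hd, if_neg hi.symm, true_and]
  refine ⟨by rw [hp]; ring, by rw [hq]; ring, fun l hl hl' => ?_⟩
  obtain ⟨-, e2, -, e4⟩ := h5 l hl hl'
  simp [hl, e2, e4]

/-- One block can be brought to `b_i = d_i = 0` without changing `a_1`, `c_1 = d_1 = 0`, or
the remaining blocks. -/
theorem exists_clear_block {m : ℤ}
    (hm : ∀ ρ ∈ lemmaOrbit hg σ, ρ (aIx ⟨0, hg⟩) = m → m ∣ ρ (dIx ⟨0, hg⟩))
    {i : Fin g} (hi : (⟨0, hg⟩ : Fin g) ≠ i) (hτ : τ ∈ lemmaOrbit hg σ)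
    (ha : τ (aIx ⟨0, hg⟩) = m) (hc : τ (cIx ⟨0, hg⟩) = 0) (hd : τ (dIx ⟨0, hg⟩) = 0) :
    ∃ ρ ∈ lemmaOrbit hg σ, ρ (aIx ⟨0, hg⟩) = m ∧ ρ (cIx ⟨0, hg⟩) = 0 ∧
      ρ (dIx ⟨0, hg⟩) = 0 ∧ ρ (bIx i) = 0 ∧ ρ (dIx i) = 0 ∧
      ∀ l, l ≠ ⟨0, hg⟩ → l ≠ i → SameBlock ρ τ l := by
  have hdvd : ∀ ρ ∈ lemmaOrbit hg σ, ρ (aIx ⟨0, hg⟩) = m → ρ (dIx ⟨0, hg⟩) = 0 →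
      m ∣ ρ (aIx i) := by
    intro ρ hρ ha hd
    obtain ⟨ρ', hρ', h1, -, h3, -⟩ := exists_mixed_shear hi 1 hρ
    have := hm ρ' hρ' (by rw [h1, ha])
    rwa [h3, hd, zero_add, one_mul] at this
  obtain ⟨τ₁, hτ₁, a1, d1, -, -, s1⟩ := exists_rotate_block i hτ
  obtain ⟨sa1, -, sc1, sd1⟩ := s1 _ hi
  have hai := hdvd τ hτ ha hd
  have hdi : m ∣ τ (dIx i) := by
    have := hdvd τ₁ hτ₁ (by rw [sa1, ha]) (by rw [sd1, hd])
    rwa [a1, dvd_neg] at this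
  obtain ⟨τ₂, hτ₂, a2, c2, d2, -, di2, s2⟩ :=
    exists_clear_d hi hτ hc hd (by rwa [ha]) (by rwa [ha])
  obtain ⟨τ₃, hτ₃, ai3, di3, -, -, s3⟩ := exists_rotate_block i hτ₂
  obtain ⟨a3, -, c3, d3⟩ := s3 _ hi
  have ai3' : τ₃ (aIx i) = 0 := by rw [ai3, di2, neg_zero]
  have hdi3 : m ∣ τ₃ (dIx i) := by
    rw [di3]
    exact hdvd τ₂ hτ₂ (a2.trans ha) d2
  obtain ⟨τ₄, hτ₄, a4, c4, d4, ai4, di4, s4⟩ :=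
    exists_clear_d hi hτ₃ (c3.trans c2) (d3.trans d2) (by simp [ai3']) (by rwa [a3, a2, ha])
  obtain ⟨τ₅, hτ₅, bi5, di5, s5⟩ := exists_b_eq_zero i hτ₄ (ai4.trans ai3') di4
  obtain ⟨a5, -, c5, d5⟩ := s5 _ hi
  refine ⟨τ₅, hτ₅, by rw [a5, a4, a3, a2, ha], c5.trans c4, d5.trans d4, bi5, di5, ?_⟩
  intro l hl hl'
  obtain ⟨p2, q2, r2, t2⟩ := s2 l hl hl'
  obtain ⟨p3, q3, r3, t3⟩ := s3 l hl'
  obtain ⟨p4, q4, r4, t4⟩ := s4 l hl hl'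
  obtain ⟨p5, q5, r5, t5⟩ := s5 l hl'
  exact ⟨by rw [p5, p4, p3, p2], by rw [q5, q4, q3, q2], by rw [r5, r4, r3, r2],
    by rw [t5, t4, t3, t2]⟩

end Orbit

/-- Lemma 2, algebraic form: every `σ ∈ H` can be moved by an element
of the subgroup of `GL(H)` generated by the `R`-maps, `D_{x_1y}`, `f_y`, `f_t` to a
class `τ` with `b_i(τ) = d_i(τ) = 0` for all `i ≥ 2` (read `i ≥ 1` in the 0-based
indexing), `c_1(τ) = d_1(τ) = 0`, `a_1(τ) ∣ b_1(τ)` and `a_1(τ) ∣ e(τ)`. -/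
theorem statement3 (g : ℕ) (hg : 0 < g) (σ : Hmod g) :
    ∃ φ ∈ Subgroup.closure (lemma2Gens g hg),
      (∀ i : Fin g, 1 ≤ (i : ℕ) → φ σ (bIx i) = 0 ∧ φ σ (dIx i) = 0) ∧
      φ σ (cIx (⟨0, hg⟩ : Fin g)) = 0 ∧ φ σ (dIx (⟨0, hg⟩ : Fin g)) = 0 ∧
      φ σ (aIx (⟨0, hg⟩ : Fin g)) ∣ φ σ (bIx (⟨0, hg⟩ : Fin g)) ∧
      φ σ (aIx (⟨0, hg⟩ : Fin g)) ∣ φ σ eIx := by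
  set o : Fin g := ⟨0, hg⟩ with ho
  obtain ⟨τ, hτ, hpivot⟩ := exists_pivot hg σ
  rw [← ho] at hpivot
  set m := τ (aIx o) with hmdef
  have hm : ∀ ρ ∈ lemmaOrbit hg σ, ρ (aIx o) = m → m ∣ ρ (dIx o) :=
    fun ρ hρ h => (hpivot ρ hρ h).1
  have hstart : ∃ ρ ∈ lemmaOrbit hg σ, ρ (aIx o) = m ∧ ρ (cIx o) = 0 ∧ ρ (dIx o) = 0 := by
    obtain ⟨⟨p, hp⟩, ⟨q, hq⟩⟩ := hpivot τ hτ rfl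
    refine ⟨_, fy_mem (-q) (Rz_mem o (-p) hτ), ?_, ?_, ?_⟩
    · rw [shear_fy_a, shear_Rz_a]
    · rw [shear_fy_c, shear_Rz_a, shear_Rz_c, hq, ← hmdef]
      ring
    · rw [shear_fy_d, shear_Rz_d, if_pos rfl, hp, ← hmdef]
      ring
  have hclear : ∀ s : Finset (Fin g), o ∉ s → ∃ ρ ∈ lemmaOrbit hg σ,
      ρ (aIx o) = m ∧ ρ (cIx o) = 0 ∧ ρ (dIx o) = 0 ∧
      ∀ i ∈ s, ρ (bIx i) = 0 ∧ ρ (dIx i) = 0 := by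
    intro s
    induction s using Finset.induction_on with
    | empty =>
      obtain ⟨ρ, hρ, h1, h2, h3⟩ := hstart
      exact fun _ => ⟨ρ, hρ, h1, h2, h3, by simp⟩
    | insert i s his ih =>
      intro hos
      rw [Finset.mem_insert, not_or] at hos
      obtain ⟨ρ, hρ, h1, h2, h3, h4⟩ := ih hos.2
      obtain ⟨ρ', hρ', h1', h2', h3', hb, hd, hs⟩ := exists_clear_block hm hos.1 hρ h1 h2 h3
      refine ⟨ρ', hρ', h1', h2', h3', fun l hl => ?_⟩
      rcases eq_or_ne l i with rfl | hli
      · exact ⟨hb, hd⟩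
      · have hls := Finset.mem_of_mem_insert_of_ne hl hli
        obtain ⟨-, e2, -, e4⟩ := hs l (fun h => hos.2 (by rwa [ho, ← h])) hli
        exact ⟨e2.trans (h4 l hls).1, e4.trans (h4 l hls).2⟩
  obtain ⟨ρ, hρ, h1, h2, h3, h4⟩ := hclear (Finset.univ.erase o) (by simp)
  have hb : m ∣ ρ (bIx o) := by
    have h := hm _ (ft_mem (-1) hρ) (by rw [shear_ft_a, h1, h2]; ring)
    rw [shear_ft_d, h3] at h
    simpa using h
  have he : m ∣ ρ eIx := by
    have h := hm _ (Dxy_mem 1 hρ) (by rw [shear_Dxy_a, h1])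
    rw [shear_Dxy_d, h3] at h
    simpa using h
  obtain ⟨φ, hφ, rfl⟩ := hρ
  refine ⟨φ, hφ, fun i hi => h4 i ?_, h2, h3, by rwa [h1], by rwa [h1]⟩
  simp only [Finset.mem_erase, Finset.mem_univ, and_true]
  rintro rfl
  simp [ho] at hi

end MinGenusT2
end
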